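/- Suppose λ(X) ≠ 0 for every dense X ∈ L ∖ {V}. Then the complex (A^•, ω_λ∧·) is exact in all degrees below r: for every 0 ≤ p < r, the kernel of the map A^p → A^{p+1} given by left multiplication by ω_λ equals ω_λ ∧ A^{p−1} (with A^{−1} = 0). -/

import Mathlib

open Module

noncomputable section

/-- An arrangement of `n` (affine) hyperplanes inside the ambient affine subspace `amb`
of the complex vector space `W`.  The linear order on the hyperplanes is the order of the
indices in `Fin n`; an arbitrary linear order is encoded by a permutation `σ` of `Fin n`,
with `i ≺ j ↔ σ i < σ j`. -/
structure HArr (W : Type) [AddCommGroup W] [Module ℂ W] (n : ℕ) where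
  amb : AffineSubspace ℂ W
  amb_ne : (amb : Set W).Nonempty
  H : Fin n → AffineSubspace ℂ W
  inj : Function.Injective H
  le_amb : ∀ i, H i ≤ amb
  nonemptyH : ∀ i, ((H i : Set W)).Nonempty
  hyp : ∀ i, finrank ℂ (H i).direction + 1 = finrank ℂ amb.direction

namespace HArr

variable {W : Type} [AddCommGroup W] [Module ℂ W] {n : ℕ}

/-- The intersection `⋂ S` of a subset of the arrangement (the ambient space for `S = ∅`). -/
def inter (A : HArr W n) (S : Finset (Fin n)) : AffineSubspace ℂ W :=
  A.amb ⊓ S.inf A.H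

/-- Codimension (inside the ambient space) of an affine subspace. -/
def cd (A : HArr W n) (X : AffineSubspace ℂ W) : ℕ :=
  finrank ℂ A.amb.direction - finrank ℂ X.direction

/-- A dependent subset of the arrangement. -/
def dep (A : HArr W n) (S : Finset (Fin n)) : Prop :=
  A.inter S ≠ ⊥ ∧ A.cd (A.inter S) < S.card

/-- An independent subset of the arrangement. -/
def indep (A : HArr W n) (S : Finset (Fin n)) : Prop :=
  A.inter S ≠ ⊥ ∧ A.cd (A.inter S) = S.card

/-- A base: a maximal independent subset. -/
def isBase (A : HArr W n) (S : Finset (Fin n)) : Prop :=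
  A.indep S ∧ ∀ T, A.indep T → S ⊆ T → S = T

open scoped Classical in
/-- The rank of a subarrangement `{H i : i ∈ C}`. -/
def rankOn (A : HArr W n) (C : Finset (Fin n)) : ℕ :=
  C.powerset.sup fun S => if A.indep S then S.card else 0

/-- The rank `r` of the arrangement. -/
def rank (A : HArr W n) : ℕ := A.rankOn Finset.univ

/-- A circuit: an inclusion-minimal dependent set. -/
def circuit (A : HArr W n) (S : Finset (Fin n)) : Prop :=
  A.dep S ∧ ∀ T ⊂ S, ¬ A.dep T

/-- A broken circuit w.r.t. the linear order given by `σ`. -/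
def brokenCircuit (A : HArr W n) (σ : Equiv.Perm (Fin n)) (S : Finset (Fin n)) : Prop :=
  ∃ i ∉ S, (∀ j ∈ S, σ i < σ j) ∧ A.circuit (insert i S)

/-- An nbc set: nonempty intersection and containing no broken circuit. -/
def nbcSet (A : HArr W n) (σ : Equiv.Perm (Fin n)) (S : Finset (Fin n)) : Prop :=
  A.inter S ≠ ⊥ ∧ ∀ T ⊆ S, ¬ A.brokenCircuit σ T

/-- An nbc-base. -/
def nbcBase (A : HArr W n) (σ : Equiv.Perm (Fin n)) (S : Finset (Fin n)) : Prop :=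
  A.nbcSet σ S ∧ A.isBase S

/-- A βnbc-base. -/
def betaNbcBase (A : HArr W n) (σ : Equiv.Perm (Fin n)) (S : Finset (Fin n)) : Prop :=
  A.nbcBase σ S ∧ ∀ i ∈ S, ∃ j, σ j < σ i ∧ A.isBase (insert j (S.erase i))

/-- Membership in the intersection poset `L(𝒜)`. -/
def memL (A : HArr W n) (X : AffineSubspace ℂ W) : Prop :=
  X ≠ ⊥ ∧ ∃ S : Finset (Fin n), A.inter S = X

/-- A maximal element of `L(𝒜)` (in the reverse-inclusion order). -/
def maximalL (A : HArr W n) (X : AffineSubspace ℂ W) : Prop :=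
  A.memL X ∧ ∀ Y, A.memL Y → Y ≤ X → Y = X

open scoped Classical in
/-- The set of indices of hyperplanes containing `X`, i.e. `𝒜_X`. -/
def sub (A : HArr W n) (X : AffineSubspace ℂ W) : Finset (Fin n) :=
  Finset.univ.filter fun i => X ≤ A.H i

/-- `X` is dense: `𝒜_X` admits no decomposition into two nonempty parts. -/
def denseL (A : HArr W n) (X : AffineSubspace ℂ W) : Prop :=
  ¬ ∃ S T : Finset (Fin n), Disjoint S T ∧ S.Nonempty ∧ T.Nonempty ∧
      S ∪ T = A.sub X ∧ A.cd (A.inter S) + A.cd (A.inter T) = A.cd X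

/-- `i` is the minimum of `S` w.r.t. the linear order given by `σ`. -/
def isMin (σ : Equiv.Perm (Fin n)) (i : Fin n) (S : Finset (Fin n)) : Prop :=
  i ∈ S ∧ ∀ j ∈ S, σ i ≤ σ j

/-- The standard ordered tuple of a finite set, w.r.t. the linear order given by `σ`:
`tup σ S p` is the element of `S` with `(p+1)`-st smallest `σ`-value. -/
def tup (σ : Equiv.Perm (Fin n)) (S : Finset (Fin n)) (p : Fin S.card) : Fin n :=
  σ.symm (((S.image ⇑σ).orderIsoOfFin (Finset.card_image_of_injective S σ.injective) p).1)

/-- The flag `ξ(B) = (X_1 > ⋯ > X_r)` of a standard ordered base: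
`flag σ S p = X_{p+1} = ⋂_{k ≥ p} H_{i_k}`. -/
def flag (A : HArr W n) (σ : Equiv.Perm (Fin n)) (S : Finset (Fin n)) (p : Fin S.card) :
    AffineSubspace ℂ W :=
  A.inter (S.filter fun i => σ (tup σ S p) ≤ σ i)

/-- Lexicographic order on standard ordered tuples (for the canonical order). -/
def lexLt (S T : Finset (Fin n)) : Prop :=
  List.Lex (· < ·) (S.sort (· ≤ ·)) (T.sort (· ≤ ·))

/-- `λ(X) = Σ_{H_i ∈ 𝒜_X} λ_i`. -/
def lamX (A : HArr W n) (lam : Fin n → ℂ) (X : AffineSubspace ℂ W) : ℂ :=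
  ∑ i ∈ A.sub X, lam i

/-- `X` is unmixed (w.r.t. the order `σ`). -/
def unmixedX (A : HArr W n) (σ : Equiv.Perm (Fin n)) (X : AffineSubspace ℂ W) : Prop :=
  (∀ S, A.nbcBase σ S → A.inter S = X → A.betaNbcBase σ S) ∨
  (∀ S, A.nbcBase σ S → A.inter S = X → ¬ A.betaNbcBase σ S)

/-- The linear order given by `σ` is unmixed. -/
def unmixedOrd (A : HArr W n) (σ : Equiv.Perm (Fin n)) : Prop :=
  ∀ X, A.maximalL X → A.unmixedX σ X

/-- Membership in the intersection poset of the deleted arrangement `𝒜 ∖ {H_{i₀}}`. -/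
def memLdel (A : HArr W n) (i₀ : Fin n) (X : AffineSubspace ℂ W) : Prop :=
  X ≠ ⊥ ∧ ∃ S : Finset (Fin n), i₀ ∉ S ∧ A.inter S = X

/-- A maximal element of the intersection poset of the deleted arrangement. -/
def maximalLdel (A : HArr W n) (i₀ : Fin n) (X : AffineSubspace ℂ W) : Prop :=
  A.memLdel i₀ X ∧ ∀ Y, A.memLdel i₀ Y → Y ≤ X → Y = X

/-- The generator `e_i` of the exterior algebra `E`. -/
def gen (i : Fin n) : ExteriorAlgebra ℂ (Fin n → ℂ) :=
  ExteriorAlgebra.ι ℂ (Pi.single i 1)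

/-- `e_S = e_{i_1} ∧ ⋯ ∧ e_{i_p}` for `S = {i_1 < ⋯ < i_p}`. -/
def eS (S : Finset (Fin n)) : ExteriorAlgebra ℂ (Fin n → ℂ) :=
  ((S.sort (· ≤ ·)).map gen).prod

/-- `∂e_S = Σ_k (−1)^{k−1} e_{S ∖ {i_k}}`. -/
def bdry (S : Finset (Fin n)) : ExteriorAlgebra ℂ (Fin n → ℂ) :=
  ∑ i ∈ S, ((-1 : ℂ) ^ (S.filter fun j => j < i).card) • eS (S.erase i)

/-- The defining relations of the Orlik–Solomon algebra. -/
inductive OSRel (A : HArr W n) :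
    ExteriorAlgebra ℂ (Fin n → ℂ) → ExteriorAlgebra ℂ (Fin n → ℂ) → Prop
  | isBot : ∀ S : Finset (Fin n), A.inter S = ⊥ → OSRel A (eS S) 0
  | isDep : ∀ S : Finset (Fin n), A.dep S → OSRel A (bdry S) 0

/-- The Orlik–Solomon algebra `A(𝒜)`: the exterior algebra modulo the ideal generated by
the `e_S` with empty intersection and the `∂e_S` with `S` dependent. -/
abbrev OS (A : HArr W n) := RingQuot (OSRel A)

/-- The quotient map `E → A(𝒜)`. -/
def osMk (A : HArr W n) : ExteriorAlgebra ℂ (Fin n → ℂ) →ₐ[ℂ] OS A :=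
  RingQuot.mkAlgHom ℂ (OSRel A)

/-- `ω_i`, the image of `e_i` in the Orlik–Solomon algebra. -/
def om (A : HArr W n) (i : Fin n) : OS A := osMk A (gen i)

/-- `ω_B`, the image of `e_B` in the Orlik–Solomon algebra. -/
def omB (A : HArr W n) (S : Finset (Fin n)) : OS A := osMk A (eS S)

/-- The degree `p` part `A^p` of the Orlik–Solomon algebra. -/
def deg (A : HArr W n) (p : ℕ) : Submodule ℂ (OS A) :=
  Submodule.span ℂ {x | ∃ S : Finset (Fin n), S.card = p ∧ x = omB A S}

/-- `ω_λ = Σ_i λ_i ω_i`. -/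
def omLam (A : HArr W n) (lam : Fin n → ℂ) : OS A := ∑ i, lam i • om A i

/-- `ω_λ(X) = Σ_{H_i ∈ 𝒜_X} λ_i ω_i`. -/
def omLamX (A : HArr W n) (lam : Fin n → ℂ) (X : AffineSubspace ℂ W) : OS A :=
  ∑ i ∈ A.sub X, lam i • om A i

/-- The form `Ξ(B) = ω_λ(X_1) ⋯ ω_λ(X_r)` attached to a standard ordered base. -/
def Xi (A : HArr W n) (σ : Equiv.Perm (Fin n)) (lam : Fin n → ℂ) (S : Finset (Fin n)) :
    OS A :=
  ((List.finRange S.card).map fun p => A.omLamX lam (A.flag σ S p)).prod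

/-- The submodule `ω_λ ∧ A^p` of the Orlik-Solomon algebra. -/
def Ideg (A : HArr W n) (lam : Fin n → ℂ) (p : ℕ) : Submodule ℂ (OS A) :=
  (A.deg p).map (LinearMap.mulLeft ℂ (A.omLam lam))

section Exterior

variable {n : ℕ}

lemma gen_mul_self (i : Fin n) : gen i * gen i = 0 :=
  ExteriorAlgebra.ι_sq_zero _

lemma gen_mul_swap (i j : Fin n) : gen i * gen j = -(gen j * gen i) :=
  eq_neg_of_add_eq_zero_left (ExteriorAlgebra.ι_add_mul_swap _ _)

lemma ι_eq_sum_gen (v : Fin n → ℂ) : ExteriorAlgebra.ι ℂ v = ∑ i, v i • gen i := by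
  have h : v = ∑ i, v i • Pi.single i (1 : ℂ) := by
    ext j
    simp [Finset.sum_apply, Pi.single_apply]
  conv_lhs => rw [h, map_sum]
  exact Finset.sum_congr rfl fun i _ => map_smul _ _ _

/-- Every element of the exterior algebra is obtained from `1` by linear combinations and
left multiplication by the generators. -/
lemma gen_induction {P : ExteriorAlgebra ℂ (Fin n → ℂ) → Prop} (one : P 1)
    (add : ∀ x y, P x → P y → P (x + y)) (smul : ∀ (c : ℂ) x, P x → P (c • x))
    (gen_mul : ∀ i x, P x → P (gen i * x)) (x : ExteriorAlgebra ℂ (Fin n → ℂ)) : P x := by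
  have zero : P 0 := by simpa using smul 0 1 one
  refine CliffordAlgebra.left_induction (Q := 0) ?_ add ?_ x
  · intro r
    rw [Algebra.algebraMap_eq_smul_one]
    exact smul r 1 one
  · intro x m hx
    change P (ExteriorAlgebra.ι ℂ m * x)
    rw [ι_eq_sum_gen, Finset.sum_mul]
    refine Finset.sum_induction _ P add zero fun i _ => ?_
    rw [smul_mul_assoc]
    exact smul _ _ (gen_mul i x hx)

lemma eS_empty : eS (∅ : Finset (Fin n)) = 1 := by simp [eS]

lemma eS_insert_min {m : Fin n} {S : Finset (Fin n)} (h : ∀ j ∈ S, m < j) :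
    eS (insert m S) = gen m * eS S := by
  have hm : m ∉ S := fun hm => lt_irrefl _ (h m hm)
  rw [eS, Finset.sort_insert _ (fun b hb => (h b hb).le) hm]
  simp [eS]

lemma gen_mul_eS_of_notMem {i : Fin n} {S : Finset (Fin n)} (hi : i ∉ S) :
    ∃ ε : ℂ, ε ≠ 0 ∧ gen i * eS S = ε • eS (insert i S) := by
  induction S using Finset.induction_on_min with
  | empty => exact ⟨1, one_ne_zero, by rw [eS_insert_min (by simp), one_smul]⟩
  | insert m S hm ih =>
    obtain ⟨him, hiS⟩ := not_or.1 (Finset.mem_insert.not.1 hi)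
    rcases lt_or_gt_of_ne him with hlt | hlt
    · refine ⟨1, one_ne_zero, ?_⟩
      rw [one_smul, eS_insert_min (m := i)]
      intro j hj
      rcases Finset.mem_insert.1 hj with rfl | hj
      · exact hlt
      · exact hlt.trans (hm j hj)
    · obtain ⟨ε, hε, h⟩ := ih hiS
      refine ⟨-ε, neg_ne_zero.2 hε, ?_⟩
      rw [eS_insert_min hm, ← mul_assoc, gen_mul_swap, neg_mul, mul_assoc, h,
        Finset.insert_comm, eS_insert_min (m := m), mul_smul_comm, neg_smul]
      intro j hj
      rcases Finset.mem_insert.1 hj with rfl | hj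
      · exact hlt
      · exact hm j hj

lemma eS_insert {i : Fin n} {S : Finset (Fin n)} (hi : i ∉ S) :
    ∃ ε : ℂ, ε ≠ 0 ∧ eS (insert i S) = ε • (gen i * eS S) := by
  obtain ⟨ε, hε, h⟩ := gen_mul_eS_of_notMem hi
  exact ⟨ε⁻¹, inv_ne_zero hε, by rw [h, smul_smul, inv_mul_cancel₀ hε, one_smul]⟩

lemma gen_mul_eS_of_mem {i : Fin n} {S : Finset (Fin n)} (hi : i ∈ S) : gen i * eS S = 0 := by
  obtain ⟨ε, -, h⟩ := eS_insert (Finset.notMem_erase i S)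
  rw [Finset.insert_erase hi] at h
  rw [h, mul_smul_comm, ← mul_assoc, gen_mul_self, zero_mul, smul_zero]

lemma mem_span_eS (x : ExteriorAlgebra ℂ (Fin n → ℂ)) :
    x ∈ Submodule.span ℂ (Set.range (eS (n := n))) := by
  induction x using gen_induction with
  | one => exact Submodule.subset_span ⟨∅, eS_empty⟩
  | add x y hx hy => exact add_mem hx hy
  | smul c x hx => exact Submodule.smul_mem _ _ hx
  | gen_mul i x hx =>
    induction hx using Submodule.span_induction with
    | mem x hx =>
      obtain ⟨S, rfl⟩ := hx
      by_cases hi : i ∈ S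
      · simp [gen_mul_eS_of_mem hi]
      · obtain ⟨ε, -, h⟩ := gen_mul_eS_of_notMem hi
        exact h ▸ Submodule.smul_mem _ _ (Submodule.subset_span ⟨_, rfl⟩)
    | zero => simp
    | add x y _ _ hx hy => exact mul_add (gen i) x y ▸ add_mem hx hy
    | smul c x _ hx => exact mul_smul_comm c (gen i) x ▸ Submodule.smul_mem _ _ hx

lemma eS_union {S T : Finset (Fin n)} (h : Disjoint S T) :
    ∃ ε : ℂ, ε ≠ 0 ∧ eS (S ∪ T) = ε • (eS S * eS T) := by
  induction S using Finset.induction_on with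
  | empty => exact ⟨1, one_ne_zero, by simp [eS_empty]⟩
  | insert i S hi ih =>
    rw [Finset.disjoint_insert_left] at h
    obtain ⟨ε, hε, h₁⟩ := ih h.2
    obtain ⟨ε₂, hε₂, h₂⟩ := eS_insert (i := i) (S := S ∪ T) (by simp [hi, h.1])
    obtain ⟨ε₃, hε₃, h₃⟩ := gen_mul_eS_of_notMem hi
    refine ⟨ε₂ * ε * ε₃, by simp [hε, hε₂, hε₃], ?_⟩
    rw [Finset.insert_union, h₂, h₁, mul_smul_comm, ← mul_assoc, h₃, smul_mul_assoc, smul_smul,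
      smul_smul]

/-- The algebra endomorphism of the exterior algebra killing the generators outside `F`. -/
def proj (F : Finset (Fin n)) :
    ExteriorAlgebra ℂ (Fin n → ℂ) →ₐ[ℂ] ExteriorAlgebra ℂ (Fin n → ℂ) :=
  ExteriorAlgebra.map (LinearMap.pi fun i => if i ∈ F then LinearMap.proj i else 0)

lemma proj_gen (F : Finset (Fin n)) (i : Fin n) :
    proj F (gen i) = if i ∈ F then gen i else 0 := by
  have h : (LinearMap.pi fun j => if j ∈ F then LinearMap.proj j else 0 :
      (Fin n → ℂ) →ₗ[ℂ] (Fin n → ℂ)) (Pi.single i 1) =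
      if i ∈ F then Pi.single i 1 else 0 := by
    ext j
    by_cases hij : j = i
    · subst hij
      by_cases hF : j ∈ F <;> simp [hF]
    · by_cases hF : j ∈ F <;> by_cases hF' : i ∈ F <;> simp [hF, hF', hij]
  rw [proj, gen, ExteriorAlgebra.map_apply_ι, h]
  split_ifs <;> simp

lemma proj_eS (F S : Finset (Fin n)) : proj F (eS S) = if S ⊆ F then eS S else 0 := by
  induction S using Finset.induction_on_min with
  | empty => simp [eS_empty]
  | insert m S hm ih =>
    rw [eS_insert_min hm, map_mul, ih, proj_gen]
    by_cases h₁ : m ∈ F <;> by_cases h₂ : S ⊆ F <;> simp [Finset.insert_subset_iff, h₁, h₂]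

lemma proj_eS_of_subset {F S : Finset (Fin n)} (h : S ⊆ F) : proj F (eS S) = eS S := by
  rw [proj_eS, if_pos h]

lemma proj_eS_of_not_subset {F S : Finset (Fin n)} (h : ¬ S ⊆ F) : proj F (eS S) = 0 := by
  rw [proj_eS, if_neg h]

lemma proj_proj (F G : Finset (Fin n)) (x : ExteriorAlgebra ℂ (Fin n → ℂ)) :
    proj F (proj G x) = proj (F ∩ G) x := by
  induction x using gen_induction with
  | one => simp
  | add x y hx hy => simp [hx, hy]
  | smul c x hx => simp [hx]
  | gen_mul i x hx =>
    rw [map_mul, map_mul, map_mul, hx, proj_gen, proj_gen]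
    by_cases h₁ : i ∈ F <;> by_cases h₂ : i ∈ G <;> simp [h₁, h₂, proj_gen]

lemma proj_eq_zero_of_subset {F G : Finset (Fin n)} (h : F ⊆ G)
    {x : ExteriorAlgebra ℂ (Fin n → ℂ)} (hx : proj G x = 0) : proj F x = 0 := by
  rw [← Finset.inter_eq_left.2 h, ← proj_proj, hx, map_zero]

lemma mem_span_eS_of_proj_eq_zero (D : Finset (Finset (Fin n)))
    {x : ExteriorAlgebra ℂ (Fin n → ℂ)} (hx : ∀ S ∈ D, proj S x = 0) :
    x ∈ Submodule.span ℂ {y | ∃ T, (∀ S ∈ D, ¬ T ⊆ S) ∧ y = eS T} := by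
  induction D using Finset.induction_on with
  | empty => simpa [Set.range, eq_comm] using mem_span_eS x
  | insert S D _ ih =>
    have h := ih fun T hT => hx T (Finset.mem_insert_of_mem hT)
    have hle : Submodule.span ℂ {y | ∃ T, (∀ S ∈ D, ¬ T ⊆ S) ∧ y = eS T} ≤
        (Submodule.span ℂ {y | ∃ T, (∀ S' ∈ insert S D, ¬ T ⊆ S') ∧ y = eS T}).comap
          (LinearMap.id - (proj S).toLinearMap) := by
      rw [Submodule.span_le]
      rintro _ ⟨T, hT, rfl⟩
      by_cases hTS : T ⊆ S
      · simp [proj_eS_of_subset hTS]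
      · refine Submodule.subset_span ⟨T, ?_, by simp [proj_eS_of_not_subset hTS]⟩
        simpa [hTS] using hT
    simpa [hx S (Finset.mem_insert_self S D)] using hle h

/-- Contraction against the linear form taking the value `φ i` on the `i`-th generator. -/
def con (φ : Fin n → ℂ) :
    ExteriorAlgebra ℂ (Fin n → ℂ) →ₗ[ℂ] ExteriorAlgebra ℂ (Fin n → ℂ) :=
  CliffordAlgebra.contractLeft (Q := 0) (∑ i, φ i • LinearMap.proj i)

lemma con_one (φ : Fin n → ℂ) : con φ 1 = 0 :=
  CliffordAlgebra.contractLeft_one _ _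

lemma con_gen_mul (φ : Fin n → ℂ) (i : Fin n) (x : ExteriorAlgebra ℂ (Fin n → ℂ)) :
    con φ (gen i * x) = φ i • x - gen i * con φ x := by
  refine (CliffordAlgebra.contractLeft_ι_mul _ _ _).trans ?_
  congr 2
  simp [Pi.single_apply]

lemma con_con (φ : Fin n → ℂ) (x : ExteriorAlgebra ℂ (Fin n → ℂ)) : con φ (con φ x) = 0 :=
  CliffordAlgebra.contractLeft_contractLeft _ _

lemma con_add_left (φ ψ : Fin n → ℂ) (x : ExteriorAlgebra ℂ (Fin n → ℂ)) :
    con (φ + ψ) x = con φ x + con ψ x := by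
  induction x using gen_induction with
  | one => simp [con_one]
  | add x y hx hy => simp only [map_add, hx, hy]; abel
  | smul c x hx => simp [hx]
  | gen_mul i x hx => rw [con_gen_mul, con_gen_mul, con_gen_mul, hx, Pi.add_apply, add_smul, mul_add]; abel

/-- The parity involution. -/
def parity : ExteriorAlgebra ℂ (Fin n → ℂ) →ₐ[ℂ] ExteriorAlgebra ℂ (Fin n → ℂ) :=
  CliffordAlgebra.involute (Q := 0)

lemma parity_gen (i : Fin n) : parity (gen i) = -gen i :=
  CliffordAlgebra.involute_ι _

lemma con_mul (φ : Fin n → ℂ) (x y : ExteriorAlgebra ℂ (Fin n → ℂ)) :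
    con φ (x * y) = con φ x * y + parity x * con φ y := by
  induction x using gen_induction with
  | one => simp [con_one]
  | add x x' hx hx' => simp only [add_mul, map_add, hx, hx']; abel
  | smul c x hx => simp [hx]
  | gen_mul i x hx =>
    rw [mul_assoc, con_gen_mul, con_gen_mul, hx, map_mul, parity_gen]
    simp only [mul_add, sub_mul, smul_mul_assoc, neg_mul, mul_assoc]
    abel

lemma con_proj {φ : Fin n → ℂ} {F : Finset (Fin n)} (h : ∀ i ∉ F, φ i = 0)
    (x : ExteriorAlgebra ℂ (Fin n → ℂ)) : con φ (proj F x) = proj F (con φ x) := by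
  induction x using gen_induction with
  | one => simp [con_one]
  | add x y hx hy => simp [hx, hy]
  | smul c x hx => simp [hx]
  | gen_mul i x hx =>
    rw [map_mul (proj F), proj_gen, con_gen_mul, map_sub, map_mul (proj F), proj_gen, map_smul]
    by_cases hi : i ∈ F
    · simp [hi, con_gen_mul, hx]
    · simp [hi, h i hi]

lemma con_eS_of_forall {φ : Fin n → ℂ} {S : Finset (Fin n)} (h : ∀ i ∈ S, φ i = 0) :
    con φ (eS S) = 0 := by
  induction S using Finset.induction_on_min with
  | empty => rw [eS_empty, con_one]
  | insert m S hm ih =>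
    rw [eS_insert_min hm, con_gen_mul, h m (Finset.mem_insert_self m S),
      ih fun i hi => h i (Finset.mem_insert_of_mem hi)]
    simp

lemma con_eS {φ : Fin n → ℂ} {S : Finset (Fin n)} (h : ∀ i ∈ S, φ i = 1) :
    con φ (eS S) = bdry S := by
  induction S using Finset.induction_on_min with
  | empty => rw [eS_empty, con_one]; simp [bdry]
  | insert m S hm ih =>
    have hmS : m ∉ S := fun hmS => lt_irrefl _ (hm m hmS)
    rw [eS_insert_min hm, con_gen_mul, h m (Finset.mem_insert_self m S),
      ih fun i hi => h i (Finset.mem_insert_of_mem hi), bdry, bdry, Finset.sum_insert hmS,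
      sub_eq_add_neg, Finset.mul_sum, ← Finset.sum_neg_distrib]
    congr 1
    · rw [Finset.erase_insert hmS, Finset.filter_eq_empty_iff.2, Finset.card_empty, pow_zero]
      intro j hj
      rcases Finset.mem_insert.1 hj with rfl | hj
      · simp
      · exact (hm j hj).not_gt
    · refine Finset.sum_congr rfl fun i hi => ?_
      have hmi := hm i hi
      rw [Finset.filter_insert, if_pos hmi, Finset.card_insert_of_notMem (by simp [hmS]),
        Finset.erase_insert_of_ne hmi.ne, eS_insert_min fun j hj => hm j (Finset.mem_of_mem_erase hj),
        pow_succ]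
      simp

/-- The degree one element `∑ λ_i e_i`. -/
def linForm (lam : Fin n → ℂ) : ExteriorAlgebra ℂ (Fin n → ℂ) := ∑ i, lam i • gen i

lemma con_linForm_mul (φ lam : Fin n → ℂ) (x : ExteriorAlgebra ℂ (Fin n → ℂ)) :
    con φ (linForm lam * x) = (∑ i, φ i * lam i) • x - linForm lam * con φ x := by
  simp only [linForm, Finset.sum_mul, map_sum, smul_mul_assoc, map_smul, con_gen_mul, smul_sub,
    Finset.sum_sub_distrib, smul_smul, Finset.sum_smul, mul_comm (lam _)]

lemma linForm_mul_self (lam : Fin n → ℂ) : linForm lam * linForm lam = 0 := by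
  have h : linForm lam = ExteriorAlgebra.ι ℂ lam := (ι_eq_sum_gen lam).symm
  rw [h, ExteriorAlgebra.ι_sq_zero]

lemma linForm_mul_linForm_mul (lam : Fin n → ℂ) (x : ExteriorAlgebra ℂ (Fin n → ℂ)) :
    linForm lam * (linForm lam * x) = 0 := by
  rw [← mul_assoc, linForm_mul_self, zero_mul]

/-- The homogeneous part of degree `p` of the exterior algebra (zero if `p < 0`). -/
def homog (n : ℕ) (p : ℤ) : Submodule ℂ (ExteriorAlgebra ℂ (Fin n → ℂ)) :=
  Submodule.span ℂ {x | ∃ S : Finset (Fin n), (S.card : ℤ) = p ∧ x = eS S}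

lemma eS_mem_homog {S : Finset (Fin n)} {p : ℤ} (h : (S.card : ℤ) = p) : eS S ∈ homog n p :=
  Submodule.subset_span ⟨S, h, rfl⟩

lemma homog_of_neg {p : ℤ} (hp : p < 0) : homog n p = ⊥ := by
  rw [homog, Submodule.span_eq_bot]
  rintro _ ⟨S, hS, rfl⟩
  omega

lemma homog_map {p q : ℤ} {f : ExteriorAlgebra ℂ (Fin n → ℂ) →ₗ[ℂ] ExteriorAlgebra ℂ (Fin n → ℂ)}
    (h : ∀ S : Finset (Fin n), (S.card : ℤ) = p → f (eS S) ∈ homog n q)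
    {x : ExteriorAlgebra ℂ (Fin n → ℂ)} (hx : x ∈ homog n p) : f x ∈ homog n q := by
  have : homog n p ≤ (homog n q).comap f := by
    rw [homog, Submodule.span_le]
    rintro _ ⟨S, hS, rfl⟩
    exact h S hS
  exact this hx

lemma proj_mem_homog (F : Finset (Fin n)) {p : ℤ} {x : ExteriorAlgebra ℂ (Fin n → ℂ)}
    (hx : x ∈ homog n p) : proj F x ∈ homog n p := by
  refine homog_map (f := (proj F).toLinearMap) (fun S hS => ?_) hx
  rw [AlgHom.toLinearMap_apply, proj_eS]
  split_ifs
  · exact eS_mem_homog hS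
  · exact zero_mem _

lemma gen_mul_mem_homog (i : Fin n) {p : ℤ} {x : ExteriorAlgebra ℂ (Fin n → ℂ)}
    (hx : x ∈ homog n p) : gen i * x ∈ homog n (p + 1) := by
  refine homog_map (f := LinearMap.mulLeft ℂ (gen i)) (fun S hS => ?_) hx
  rw [LinearMap.mulLeft_apply]
  by_cases hi : i ∈ S
  · rw [gen_mul_eS_of_mem hi]
    exact zero_mem _
  · obtain ⟨ε, -, h⟩ := gen_mul_eS_of_notMem hi
    rw [h]
    exact Submodule.smul_mem _ _ (eS_mem_homog (by rw [Finset.card_insert_of_notMem hi]; omega))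

lemma linForm_mul_mem_homog (lam : Fin n → ℂ) {p : ℤ} {x : ExteriorAlgebra ℂ (Fin n → ℂ)}
    (hx : x ∈ homog n p) : linForm lam * x ∈ homog n (p + 1) := by
  rw [linForm, Finset.sum_mul]
  refine sum_mem fun i _ => ?_
  rw [smul_mul_assoc]
  exact Submodule.smul_mem _ _ (gen_mul_mem_homog i hx)

lemma con_eS_mem_homog (φ : Fin n → ℂ) (S : Finset (Fin n)) :
    con φ (eS S) ∈ homog n (S.card - 1) := by
  induction S using Finset.induction_on_min with
  | empty => rw [eS_empty, con_one]; exact zero_mem _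
  | insert m S hm ih =>
    have hmS : m ∉ S := fun hmS => lt_irrefl _ (hm m hmS)
    rw [eS_insert_min hm, con_gen_mul, Finset.card_insert_of_notMem hmS]
    refine sub_mem (Submodule.smul_mem _ _ (eS_mem_homog (by simp))) ?_
    convert gen_mul_mem_homog m ih using 2
    push_cast
    ring

lemma con_mem_homog (φ : Fin n → ℂ) {p : ℤ} {x : ExteriorAlgebra ℂ (Fin n → ℂ)}
    (hx : x ∈ homog n p) : con φ x ∈ homog n (p - 1) :=
  homog_map (fun S hS => hS ▸ con_eS_mem_homog φ S) hx

lemma mul_gen_of_mem_homog (i : Fin n) {p : ℤ} {x : ExteriorAlgebra ℂ (Fin n → ℂ)}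
    (hx : x ∈ homog n p) : x * gen i = (-1 : ℂ) ^ p • (gen i * x) := by
  induction hx using Submodule.span_induction with
  | mem x hx =>
    obtain ⟨S, rfl, rfl⟩ := hx
    rw [zpow_natCast]
    induction S using Finset.induction_on_min with
    | empty => simp [eS_empty]
    | insert m S hm ih =>
      have hmS : m ∉ S := fun hmS => lt_irrefl _ (hm m hmS)
      rw [eS_insert_min hm, mul_assoc, ih, Finset.card_insert_of_notMem hmS, mul_smul_comm,
        ← mul_assoc, gen_mul_swap m i, pow_succ, ← mul_assoc]
      simp
  | zero => simp
  | add x y _ _ hx hy => rw [add_mul, hx, hy, mul_add, smul_add]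
  | smul c x _ hx => rw [smul_mul_assoc, hx, mul_smul_comm, smul_comm]

end Exterior

section Geometry

variable {W : Type} [AddCommGroup W] [Module ℂ W] {n : ℕ} (A : HArr W n)

lemma mem_inter {S : Finset (Fin n)} {o : W} :
    o ∈ A.inter S ↔ o ∈ A.amb ∧ ∀ i ∈ S, o ∈ A.H i := by
  rw [inter, AffineSubspace.mem_inf_iff]
  refine and_congr_right fun _ => ?_
  induction S using Finset.induction_on with
  | empty => simp
  | insert i S _ ih => simp [AffineSubspace.mem_inf_iff, ih]

lemma exists_mem_of_ne_bot {X : AffineSubspace ℂ W} (h : X ≠ ⊥) : ∃ o, o ∈ X :=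
  (AffineSubspace.nonempty_iff_ne_bot X).2 h

lemma ne_bot_of_mem {X : AffineSubspace ℂ W} {o : W} (h : o ∈ X) : X ≠ ⊥ :=
  (AffineSubspace.nonempty_iff_ne_bot X).1 ⟨o, h⟩

lemma inter_anti {S T : Finset (Fin n)} (h : S ⊆ T) : A.inter T ≤ A.inter S := by
  intro o ho
  rw [mem_inter] at ho ⊢
  exact ⟨ho.1, fun i hi => ho.2 i (h hi)⟩

lemma inter_empty : A.inter ∅ = A.amb := by simp [inter]

lemma mem_sub {X : AffineSubspace ℂ W} {i : Fin n} : i ∈ A.sub X ↔ X ≤ A.H i := by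
  simp [sub]

lemma subset_sub_inter (S : Finset (Fin n)) : S ⊆ A.sub (A.inter S) := fun i hi =>
  (mem_sub A).2 fun _ ho => ((mem_inter A).1 ho).2 i hi

/-- The intersection of the directions of the hyperplanes in `S`. -/
def dirInter (S : Finset (Fin n)) : Submodule ℂ W :=
  A.amb.direction ⊓ S.inf fun i => (A.H i).direction

lemma mem_dirInter {S : Finset (Fin n)} {v : W} :
    v ∈ A.dirInter S ↔ v ∈ A.amb.direction ∧ ∀ i ∈ S, v ∈ (A.H i).direction := by
  simp [dirInter, Submodule.mem_finsetInf]

lemma direction_inter {S : Finset (Fin n)} (h : A.inter S ≠ ⊥) :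
    (A.inter S).direction = A.dirInter S := by
  obtain ⟨o, ho⟩ := exists_mem_of_ne_bot h
  have ho' := (mem_inter A).1 ho
  ext v
  rw [← AffineSubspace.vadd_mem_iff_mem_direction v ho, mem_inter, mem_dirInter,
    AffineSubspace.vadd_mem_iff_mem_direction v ho'.1]
  exact and_congr_right fun _ => forall₂_congr fun i hi =>
    AffineSubspace.vadd_mem_iff_mem_direction v (ho'.2 i hi)

lemma dirInter_empty : A.dirInter ∅ = A.amb.direction := by simp [dirInter]

lemma dirInter_union (S T : Finset (Fin n)) :
    A.dirInter (S ∪ T) = A.dirInter S ⊓ A.dirInter T := by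
  ext v
  simp only [mem_dirInter, Submodule.mem_inf, Finset.mem_union]
  grind

lemma dirInter_anti {S T : Finset (Fin n)} (h : S ⊆ T) : A.dirInter T ≤ A.dirInter S := by
  intro v hv
  rw [mem_dirInter] at hv ⊢
  exact ⟨hv.1, fun i hi => hv.2 i (h hi)⟩

lemma dirInter_le_amb (S : Finset (Fin n)) : A.dirInter S ≤ A.amb.direction := inf_le_left

lemma dirInter_le_of_mem {S : Finset (Fin n)} {i : Fin n} (hi : i ∈ S) :
    A.dirInter S ≤ (A.H i).direction := fun _ hv => ((mem_dirInter A).1 hv).2 i hi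

lemma not_amb_direction_le (i : Fin n) : ¬ A.amb.direction ≤ (A.H i).direction := by
  intro h
  have := A.hyp i
  rw [le_antisymm h (AffineSubspace.direction_le (A.le_amb i))] at this
  omega

lemma sub_amb : A.sub A.amb = ∅ := by
  refine Finset.eq_empty_of_forall_notMem fun i hi => A.not_amb_direction_le i ?_
  exact AffineSubspace.direction_le ((mem_sub A).1 hi)

/-- The index sets of the form `𝒜_X`. -/
def isFlat (F : Finset (Fin n)) : Prop := A.inter F ≠ ⊥ ∧ A.sub (A.inter F) = F

lemma isFlat_sub_inter {S : Finset (Fin n)} (h : A.inter S ≠ ⊥) :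
    A.isFlat (A.sub (A.inter S)) := by
  have heq : A.inter (A.sub (A.inter S)) = A.inter S := by
    refine le_antisymm (A.inter_anti (A.subset_sub_inter S)) fun o ho => ?_
    exact (mem_inter A).2 ⟨((mem_inter A).1 ho).1, fun i hi => (mem_sub A).1 hi ho⟩
  exact ⟨by rw [heq]; exact h, by rw [heq]⟩

lemma isFlat_inter {F G : Finset (Fin n)} (hF : A.isFlat F) (hG : A.isFlat G) :
    A.isFlat (F ∩ G) := by
  have h : A.inter (F ∩ G) ≠ ⊥ := by
    obtain ⟨o, ho⟩ := exists_mem_of_ne_bot hF.1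
    exact ne_bot_of_mem (A.inter_anti Finset.inter_subset_left ho)
  refine ⟨h, Finset.Subset.antisymm (fun i hi => ?_) (A.subset_sub_inter _)⟩
  rw [mem_sub] at hi
  rw [Finset.mem_inter, ← hF.2, ← hG.2, mem_sub, mem_sub]
  exact ⟨(A.inter_anti Finset.inter_subset_left).trans hi,
    (A.inter_anti Finset.inter_subset_right).trans hi⟩

lemma le_of_direction_le {X Y : AffineSubspace ℂ W} {o : W} (hX : o ∈ X) (hY : o ∈ Y)
    (h : X.direction ≤ Y.direction) : X ≤ Y := by
  intro p hp
  rw [← vsub_vadd p o]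
  exact AffineSubspace.vadd_mem_of_mem_direction (h (AffineSubspace.vsub_mem_direction hp hX)) hY

variable [FiniteDimensional ℂ W]

lemma cd_inter {S : Finset (Fin n)} (h : A.inter S ≠ ⊥) :
    A.cd (A.inter S) + finrank ℂ (A.dirInter S) = finrank ℂ A.amb.direction := by
  rw [cd, direction_inter A h]
  exact Nat.sub_add_cancel (Submodule.finrank_mono (A.dirInter_le_amb S))

/-- Codimensions of two sets of hyperplanes with a common point add up exactly when the
intersections of these sets are transversal. -/
lemma cd_add_cd_eq_iff {S T : Finset (Fin n)} (h : A.inter (S ∪ T) ≠ ⊥) :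
    A.cd (A.inter S) + A.cd (A.inter T) = A.cd (A.inter (S ∪ T)) ↔
      A.dirInter S ⊔ A.dirInter T = A.amb.direction := by
  obtain ⟨o, ho⟩ := exists_mem_of_ne_bot h
  have hS := A.cd_inter (ne_bot_of_mem (A.inter_anti Finset.subset_union_left ho))
  have hT := A.cd_inter (ne_bot_of_mem (A.inter_anti Finset.subset_union_right ho))
  have hST := A.cd_inter h
  rw [dirInter_union] at hST
  have key := Submodule.finrank_sup_add_finrank_inf_eq (A.dirInter S) (A.dirInter T)
  have hle : A.dirInter S ⊔ A.dirInter T ≤ A.amb.direction :=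
    sup_le (A.dirInter_le_amb S) (A.dirInter_le_amb T)
  have hle' := Submodule.finrank_mono hle
  constructor
  · intro heq
    exact Submodule.eq_of_le_of_finrank_eq hle (by omega)
  · intro heq
    rw [heq] at key
    omega

lemma rank_add_finrank_le : A.rank + finrank ℂ (A.dirInter Finset.univ) ≤
    finrank ℂ A.amb.direction := by
  classical
  have hle : finrank ℂ (A.dirInter Finset.univ) ≤ finrank ℂ A.amb.direction :=
    Submodule.finrank_mono (A.dirInter_le_amb _)
  suffices h : A.rank ≤ finrank ℂ A.amb.direction - finrank ℂ (A.dirInter Finset.univ) by omega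
  rw [rank, rankOn]
  refine Finset.sup_le fun S _ => ?_
  split_ifs with hS
  · have h₁ := A.cd_inter hS.1
    have h₂ := Submodule.finrank_mono (A.dirInter_anti (Finset.subset_univ S))
    have h₃ := hS.2
    omega
  · exact Nat.zero_le _

end Geometry

lemma parity_eS {n : ℕ} (S : Finset (Fin n)) : parity (eS S) = (-1 : ℂ) ^ S.card • eS S := by
  induction S using Finset.induction_on_min with
  | empty => simp [eS_empty]
  | insert m S hm ih =>
    have hmS : m ∉ S := fun hmS => lt_irrefl _ (hm m hmS)
    rw [eS_insert_min hm, map_mul, ih, parity_gen, Finset.card_insert_of_notMem hmS, pow_succ]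
    simp

lemma bdry_mem_homog {n : ℕ} (S : Finset (Fin n)) : bdry S ∈ homog n (S.card - 1) := by
  rw [← con_eS (φ := 1) fun _ _ => rfl]
  exact con_eS_mem_homog _ _

lemma eS_eq_gen_mul_bdry {n : ℕ} {S : Finset (Fin n)} {i : Fin n} (hi : i ∈ S) :
    eS S = gen i * bdry S := by
  have h := con_gen_mul 1 i (eS S)
  rw [gen_mul_eS_of_mem hi, map_zero, con_eS (fun _ _ => Pi.one_apply _), Pi.one_apply, one_smul] at h
  exact sub_eq_zero.1 h.symm

section Relations

variable {W : Type} [AddCommGroup W] [Module ℂ W] {n : ℕ} (A : HArr W n)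

/-- The relations of the Orlik–Solomon algebra generate its kernel already as a left ideal,
since they are homogeneous. -/
lemma mem_span_of_osMk_eq_zero {u : ExteriorAlgebra ℂ (Fin n → ℂ)} (hu : A.osMk u = 0) :
    u ∈ Ideal.span {r | OSRel A r 0} := by
  set M := Ideal.span {r | OSRel A r 0} with hM
  have hgen : ∀ i, ∀ a ∈ M, a * gen i ∈ M := by
    intro i a ha
    induction ha using Submodule.span_induction with
    | mem r hr =>
      obtain ⟨p, hp⟩ : ∃ p : ℤ, r ∈ homog n p := by
        cases hr with
        | isBot S _ => exact ⟨_, eS_mem_homog rfl⟩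
        | isDep S _ => exact ⟨_, bdry_mem_homog S⟩
      rw [mul_gen_of_mem_homog i hp, ← smul_mul_assoc]
      exact M.mul_mem_left _ (Ideal.subset_span hr)
    | zero => rw [zero_mul]; exact zero_mem _
    | add x y _ _ hx hy => rw [add_mul]; exact add_mem hx hy
    | smul c x _ hx => rw [smul_eq_mul, mul_assoc]; exact M.mul_mem_left _ hx
  have hmul : ∀ b, ∀ a ∈ M, a * b ∈ M := by
    intro b
    induction b using gen_induction with
    | one => intro a ha; rwa [mul_one]
    | add x y hx hy => intro a ha; rw [mul_add]; exact add_mem (hx a ha) (hy a ha)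
    | smul c x hx =>
      intro a ha
      rw [mul_smul_comm, ← one_mul (a * x), ← smul_mul_assoc]
      exact M.mul_mem_left _ (hx a ha)
    | gen_mul i x hx => intro a ha; rw [← mul_assoc]; exact hx _ (hgen i a ha)
  have : M.IsTwoSided := ⟨fun b ha => hmul b _ ha⟩
  let f : OS A →ₐ[ℂ] ExteriorAlgebra ℂ (Fin n → ℂ) ⧸ M :=
    RingQuot.liftAlgHom ℂ ⟨Ideal.Quotient.mkₐ ℂ M, fun x y h => by
      have hxy : y = 0 := by cases h <;> rfl
      subst hxy
      rw [map_zero, Ideal.Quotient.mkₐ_eq_mk, Ideal.Quotient.eq_zero_iff_mem]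
      exact Ideal.subset_span h⟩
  have hf : f (A.osMk u) = Ideal.Quotient.mkₐ ℂ M u := RingQuot.liftAlgHom_mkAlgHom_apply ..
  rw [hu, map_zero] at hf
  rw [← Ideal.Quotient.eq_zero_iff_mem]
  exact hf.symm

lemma osMk_eS_of_inter_eq_bot {S : Finset (Fin n)} (h : A.inter S = ⊥) : A.osMk (eS S) = 0 := by
  rw [osMk, RingQuot.mkAlgHom_rel ℂ (OSRel.isBot S h), map_zero]

lemma osMk_bdry {S : Finset (Fin n)} (h : A.dep S) : A.osMk (bdry S) = 0 := by
  rw [osMk, RingQuot.mkAlgHom_rel ℂ (OSRel.isDep S h), map_zero]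

lemma osMk_eS_of_dep {S : Finset (Fin n)} (h : A.dep S) : A.osMk (eS S) = 0 := by
  obtain ⟨i, hi⟩ := Finset.card_pos.1 (Nat.zero_lt_of_lt h.2)
  rw [eS_eq_gen_mul_bdry hi, map_mul, osMk_bdry A h, mul_zero]

lemma osMk_induction {P : ExteriorAlgebra ℂ (Fin n → ℂ) → Prop}
    (bot : ∀ S, A.inter S = ⊥ → P (eS S)) (dep : ∀ S, A.dep S → P (bdry S)) (zero : P 0)
    (add : ∀ x y, P x → P y → P (x + y)) (smul : ∀ (c : ℂ) x, P x → P (c • x))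
    (gen_mul : ∀ i x, P x → P (gen i * x)) {u : ExteriorAlgebra ℂ (Fin n → ℂ)}
    (hu : A.osMk u = 0) : P u := by
  have hu' := A.mem_span_of_osMk_eq_zero hu
  clear hu
  induction hu' using Submodule.span_induction with
  | mem r hr =>
    cases hr with
    | isBot S h => exact bot S h
    | isDep S h => exact dep S h
  | zero => exact zero
  | add x y _ _ hx hy => exact add x y hx hy
  | smul c x _ hx =>
    rw [smul_eq_mul]
    induction c using gen_induction with
    | one => rwa [one_mul]
    | add a b ha hb => rw [add_mul]; exact add _ _ ha hb
    | smul c a ha => rw [smul_mul_assoc]; exact smul _ _ ha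
    | gen_mul i a ha => rw [mul_assoc]; exact gen_mul _ _ ha

lemma not_subset_of_inter_eq_bot {S F : Finset (Fin n)} (hF : A.isFlat F) (hS : A.inter S = ⊥) :
    ¬ S ⊆ F := fun h => hF.1 (le_bot_iff.1 (hS ▸ A.inter_anti h))

variable [FiniteDimensional ℂ W]

lemma dep_erase {S F : Finset (Fin n)} (hF : A.isFlat F) (hS : A.dep S) (hSF : ¬ S ⊆ F)
    {i : Fin n} (hi : i ∈ S) (hiF : S.erase i ⊆ F) : A.dep (S.erase i) := by
  have hiF' : i ∉ F := fun h => hSF fun j hj => by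
    by_cases hji : j = i
    · exact hji ▸ h
    · exact hiF (Finset.mem_erase.2 ⟨hji, hj⟩)
  obtain ⟨o, ho⟩ := exists_mem_of_ne_bot hS.1
  have ho' := A.inter_anti (Finset.erase_subset i S) ho
  have hb := ne_bot_of_mem ho'
  refine ⟨hb, ?_⟩
  have h₁ := A.cd_inter hS.1
  have h₂ := A.cd_inter hb
  have h₃ : finrank ℂ (A.dirInter S) < finrank ℂ (A.dirInter (S.erase i)) := by
    refine Submodule.finrank_lt_finrank_of_lt
      (lt_of_le_of_ne (A.dirInter_anti (Finset.erase_subset i S)) fun heq => hiF' ?_)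
    rw [← hF.2, mem_sub]
    refine (A.inter_anti hiF).trans (le_of_direction_le ho' (((mem_inter A).1 ho).2 i hi) ?_)
    rw [direction_inter A hb, ← heq]
    exact A.dirInter_le_of_mem hi
  have h₄ := Finset.card_erase_add_one hi
  have h₅ := hS.2
  omega

lemma proj_bdry_of_subset {S F : Finset (Fin n)} (h : S ⊆ F) : proj F (bdry S) = bdry S := by
  simp only [bdry, map_sum, map_smul]
  refine Finset.sum_congr rfl fun i _ => ?_
  rw [proj_eS_of_subset ((Finset.erase_subset _ _).trans h)]

lemma osMk_proj {F : Finset (Fin n)} (hF : A.isFlat F) {u : ExteriorAlgebra ℂ (Fin n → ℂ)}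
    (hu : A.osMk u = 0) : A.osMk (proj F u) = 0 := by
  refine osMk_induction A (P := fun u => A.osMk (proj F u) = 0) (fun S hS => ?_) (fun S hS => ?_)
    (by simp) (fun x y hx hy => by simp [hx, hy]) (fun c x hx => by simp [hx])
    (fun i x hx => by simp [hx]) hu
  · rw [proj_eS_of_not_subset (A.not_subset_of_inter_eq_bot hF hS), map_zero]
  · by_cases hSF : S ⊆ F
    · rw [proj_bdry_of_subset hSF, osMk_bdry A hS]
    · simp only [bdry, map_sum, map_smul]
      refine Finset.sum_eq_zero fun i hi => ?_
      rw [proj_eS]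
      split_ifs with h
      · rw [osMk_eS_of_dep A (A.dep_erase hF hS hSF hi h), smul_zero]
      · rw [map_zero, smul_zero]

lemma two_le_card_of_dep {S : Finset (Fin n)} (hS : A.dep S) : 2 ≤ S.card := by
  by_contra! h
  obtain ⟨i, hi⟩ := Finset.card_pos.1 (Nat.zero_lt_of_lt hS.2)
  have h₁ := A.cd_inter hS.1
  have h₂ : finrank ℂ (A.dirInter S) ≤ finrank ℂ (A.H i).direction :=
    Submodule.finrank_mono (A.dirInter_le_of_mem hi)
  have h₃ := A.hyp i
  have h₄ := hS.2
  omega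

lemma proj_empty_eq_zero {u : ExteriorAlgebra ℂ (Fin n → ℂ)} (hu : A.osMk u = 0) :
    proj ∅ u = 0 := by
  have key : ∀ S : Finset (Fin n), S.Nonempty → proj ∅ (eS S) = 0 := fun S hS =>
    proj_eS_of_not_subset fun h => hS.ne_empty (Finset.subset_empty.1 h)
  refine osMk_induction A (P := fun u => proj ∅ u = 0) (fun S hS => ?_) (fun S hS => ?_)
    (by simp) (fun x y hx hy => by simp [hx, hy]) (fun c x hx => by simp [hx])
    (fun i x hx => by simp [hx]) hu
  · refine key S (Finset.nonempty_iff_ne_empty.2 ?_)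
    rintro rfl
    rw [inter_empty] at hS
    exact (AffineSubspace.nonempty_iff_ne_bot A.amb).1 A.amb_ne hS
  · simp only [bdry, map_sum, map_smul]
    refine Finset.sum_eq_zero fun i hi => ?_
    have h := A.two_le_card_of_dep hS
    rw [key, smul_zero]
    rw [← Finset.card_pos, Finset.card_erase_of_mem hi]
    omega

lemma exists_transversal {lam : Fin n → ℂ}
    (hlam : ∀ X, A.memL X → X ≠ A.amb → A.denseL X → A.lamX lam X ≠ 0)
    {F : Finset (Fin n)} (hF : A.isFlat F) (hne : F.Nonempty) :
    ∃ S ⊆ F, A.dirInter S ⊔ A.dirInter (F \ S) = A.amb.direction ∧ ∑ i ∈ S, lam i ≠ 0 := by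
  classical
  obtain ⟨S, hS, hmin⟩ := Finset.exists_min_image
    (F.powerset.filter fun S => S.Nonempty ∧ A.dirInter S ⊔ A.dirInter (F \ S) = A.amb.direction)
    Finset.card ⟨F, by simp [hne, dirInter_empty, dirInter_le_amb]⟩
  simp only [Finset.mem_filter, Finset.mem_powerset] at hS hmin
  obtain ⟨hSF, hSne, hsup⟩ := hS
  obtain ⟨o, ho⟩ := exists_mem_of_ne_bot hF.1
  have hb : A.inter S ≠ ⊥ := ne_bot_of_mem (A.inter_anti hSF ho)
  have hsub : A.sub (A.inter S) = S := by
    refine Finset.Subset.antisymm (fun i hi => ?_) (A.subset_sub_inter S)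
    by_contra hiS
    have hiX := (mem_sub A).1 hi
    have hiF : i ∈ F := by
      rw [← hF.2, mem_sub]
      exact (A.inter_anti hSF).trans hiX
    refine A.not_amb_direction_le i ?_
    rw [← hsup]
    refine sup_le ?_ (A.dirInter_le_of_mem (Finset.mem_sdiff.2 ⟨hiF, hiS⟩))
    rw [← direction_inter A hb]
    exact AffineSubspace.direction_le hiX
  refine ⟨S, hSF, hsup, ?_⟩
  have key := hlam (A.inter S) ⟨hb, S, rfl⟩ ?_ ?_
  · rwa [lamX, hsub] at key
  · intro h
    rw [h, sub_amb] at hsub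
    exact hSne.ne_empty hsub.symm
  · rintro ⟨T, T', hdisj, hT, hT', hun, hcd⟩
    rw [hsub] at hun
    subst hun
    rw [cd_add_cd_eq_iff A hb] at hcd
    have hcard := hmin T ⟨Finset.subset_union_left.trans hSF, hT, ?_⟩
    · rw [Finset.card_union_of_disjoint hdisj] at hcard
      have := Finset.card_pos.2 hT'
      omega
    · refine le_antisymm (sup_le (A.dirInter_le_amb _) (A.dirInter_le_amb _)) ?_
      have hsplit : F \ T = T' ∪ F \ (T ∪ T') := by
        ext i
        have h₁ : i ∈ T' → i ∉ T := fun h h' => Finset.disjoint_left.1 hdisj h' h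
        have h₂ : i ∈ T' → i ∈ F := fun h => hSF (Finset.mem_union_right _ h)
        simp only [Finset.mem_sdiff, Finset.mem_union]
        tauto
      rw [hsplit, dirInter_union]
      intro v hv
      obtain ⟨a, ha, b, hb, rfl⟩ := Submodule.mem_sup.1 (hcd ▸ hv)
      obtain ⟨c, hc, d, hd, rfl⟩ := Submodule.mem_sup.1 (hsup ▸ A.dirInter_le_amb _ hb)
      rw [dirInter_union] at hc
      rw [← add_assoc]
      refine Submodule.add_mem_sup (add_mem ha hc.1) ⟨?_, hd⟩
      rw [← add_sub_cancel_left c d]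
      exact sub_mem hb hc.2

end Relations

section Contraction

variable {n : ℕ}

lemma exists_con_bdry (S T : Finset (Fin n)) :
    ∃ c : ℂ, con (fun i => if i ∈ S then 1 else 0) (bdry T) =
      c • (bdry (T ∩ S) * bdry (T \ S)) := by
  set φ : Fin n → ℂ := fun i => if i ∈ S then 1 else 0 with hφ
  set ψ : Fin n → ℂ := fun i => if i ∈ S then 0 else 1 with hψ
  obtain ⟨ε, -, hε⟩ := eS_union (Finset.disjoint_sdiff_inter T S).symm
  rw [Finset.union_comm, Finset.sdiff_union_inter] at hε
  have hone : bdry T = con φ (eS T) + con ψ (eS T) := by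
    rw [← con_add_left, con_eS]
    intro i _
    by_cases hi : i ∈ S <;> simp [hφ, hψ, hi]
  have h₁ : con φ (eS (T ∩ S)) = bdry (T ∩ S) :=
    con_eS fun i hi => if_pos (Finset.mem_inter.1 hi).2
  have h₂ : con ψ (eS (T \ S)) = bdry (T \ S) :=
    con_eS fun i hi => if_neg (Finset.mem_sdiff.1 hi).2
  have h₃ : con ψ (eS (T ∩ S)) = 0 :=
    con_eS_of_forall fun i hi => if_pos (Finset.mem_inter.1 hi).2
  have h₄ : con φ (bdry (T \ S)) = 0 := by
    simp only [bdry, map_sum, map_smul]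
    refine Finset.sum_eq_zero fun i _ => ?_
    rw [con_eS_of_forall, smul_zero]
    exact fun j hj => if_neg (Finset.mem_sdiff.1 (Finset.mem_of_mem_erase hj)).2
  refine ⟨ε * (-1) ^ (T ∩ S).card, ?_⟩
  rw [hone, map_add, con_con, zero_add, hε, map_smul, con_mul, h₃, zero_mul, zero_add, h₂,
    parity_eS, smul_mul_assoc, map_smul, map_smul, con_mul, h₁, h₄, mul_zero, add_zero, smul_smul]

end Contraction

section Acyclic

variable {W : Type} [AddCommGroup W] [Module ℂ W] [FiniteDimensional ℂ W] {n : ℕ} (A : HArr W n)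

lemma dep_inter_or_dep_sdiff {S T F : Finset (Fin n)} (hTF : T ⊆ F)
    (h : A.dirInter S ⊔ A.dirInter (F \ S) = A.amb.direction) (hT : A.dep T) :
    A.dep (T ∩ S) ∨ A.dep (T \ S) := by
  obtain ⟨o, ho⟩ := exists_mem_of_ne_bot hT.1
  have hb₁ := ne_bot_of_mem (A.inter_anti (Finset.inter_subset_left (s₂ := S)) ho)
  have hb₂ := ne_bot_of_mem (A.inter_anti (Finset.sdiff_subset (t := S)) ho)
  have hun : (T ∩ S) ∪ (T \ S) = T := by
    rw [Finset.union_comm, Finset.sdiff_union_inter]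
  have hcd := (A.cd_add_cd_eq_iff (S := T ∩ S) (T := T \ S) (by rw [hun]; exact hT.1)).2
    (le_antisymm (sup_le (A.dirInter_le_amb _) (A.dirInter_le_amb _)) (by
      rw [← h]
      exact sup_le_sup (A.dirInter_anti Finset.inter_subset_right)
        (A.dirInter_anti (Finset.sdiff_subset_sdiff hTF subset_rfl))))
  rw [hun] at hcd
  have hcard := Finset.card_inter_add_card_sdiff T S
  have := hT.2
  by_cases hlt : A.cd (A.inter (T ∩ S)) < (T ∩ S).card
  · exact Or.inl ⟨hb₁, hlt⟩
  · exact Or.inr ⟨hb₂, by omega⟩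

lemma osMk_con_bdry {S T F : Finset (Fin n)} (hTF : T ⊆ F)
    (h : A.dirInter S ⊔ A.dirInter (F \ S) = A.amb.direction) (hT : A.dep T) :
    A.osMk (con (fun i => if i ∈ S then 1 else 0) (bdry T)) = 0 := by
  obtain ⟨c, hc⟩ := exists_con_bdry S T
  rw [hc, map_smul, map_mul]
  rcases A.dep_inter_or_dep_sdiff hTF h hT with hd | hd
  · rw [osMk_bdry A hd, zero_mul, smul_zero]
  · rw [osMk_bdry A hd, mul_zero, smul_zero]

lemma osMk_con_eS {S T F : Finset (Fin n)} (hTF : T ⊆ F)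
    (h : A.dirInter S ⊔ A.dirInter (F \ S) = A.amb.direction) (hT : A.dep T) :
    A.osMk (con (fun i => if i ∈ S then 1 else 0) (eS T)) = 0 := by
  obtain ⟨i, hi⟩ := Finset.card_pos.1 (Nat.zero_lt_of_lt hT.2)
  rw [eS_eq_gen_mul_bdry hi, con_gen_mul, map_sub, map_smul, map_mul, osMk_bdry A hT,
    A.osMk_con_bdry hTF h hT, mul_zero, smul_zero, sub_zero]

/-- Contraction along a direct factor of a flat preserves the relations. -/
lemma osMk_con_proj {S F : Finset (Fin n)} (hF : A.isFlat F)
    (h : A.dirInter S ⊔ A.dirInter (F \ S) = A.amb.direction)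
    {u : ExteriorAlgebra ℂ (Fin n → ℂ)} (hu : A.osMk u = 0) :
    A.osMk (con (fun i => if i ∈ S then 1 else 0) (proj F u)) = 0 := by
  set φ : Fin n → ℂ := fun i => if i ∈ S then 1 else 0 with hφ
  refine (osMk_induction A (P := fun u => A.osMk (proj F u) = 0 ∧ A.osMk (con φ (proj F u)) = 0)
    (fun T hT => ?_) (fun T hT => ?_) (by simp) (fun x y hx hy => by simp [hx.1, hx.2, hy.1, hy.2])
    (fun c x hx => by simp [hx.1, hx.2]) (fun i x hx => ?_) hu).2
  · rw [proj_eS_of_not_subset (A.not_subset_of_inter_eq_bot hF hT)]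
    simp
  · refine ⟨A.osMk_proj hF (A.osMk_bdry hT), ?_⟩
    by_cases hTF : T ⊆ F
    · rw [proj_bdry_of_subset hTF, A.osMk_con_bdry hTF h hT]
    · simp only [bdry, map_sum, map_smul]
      refine Finset.sum_eq_zero fun i hi => ?_
      rw [proj_eS]
      split_ifs with hT'
      · rw [A.osMk_con_eS hT' h (A.dep_erase hF hT hTF hi hT'), smul_zero]
      · rw [map_zero, map_zero, smul_zero]
  · rw [map_mul, proj_gen]
    split_ifs
    · simp [con_gen_mul, hx.1, hx.2]
    · simp

variable {A} {lam : Fin n → ℂ}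

lemma exists_primitive_of_isFlat
    (hlam : ∀ X, A.memL X → X ≠ A.amb → A.denseL X → A.lamX lam X ≠ 0)
    {F : Finset (Fin n)} (hF : A.isFlat F) {p : ℤ}
    {u : ExteriorAlgebra ℂ (Fin n → ℂ)} (hu : A.osMk u = 0) (hup : u ∈ homog n (p + 1))
    (hd : proj F (linForm lam * u) = 0) :
    ∃ v, A.osMk v = 0 ∧ v ∈ homog n p ∧ proj F (u - linForm lam * v) = 0 := by
  rcases F.eq_empty_or_nonempty with rfl | hne
  · exact ⟨0, map_zero _, zero_mem _, by rw [mul_zero, sub_zero, A.proj_empty_eq_zero hu]⟩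
  obtain ⟨S, hSF, hsup, hS⟩ := A.exists_transversal hlam hF hne
  set φ : Fin n → ℂ := fun i => if i ∈ S then 1 else 0 with hφ
  have hφF : ∀ i ∉ F, φ i = 0 := fun i hi => if_neg fun h => hi (hSF h)
  have hsum : ∑ i, φ i * lam i = ∑ i ∈ S, lam i := by simp [hφ]
  refine ⟨(∑ i ∈ S, lam i)⁻¹ • con φ (proj F u), ?_, ?_, ?_⟩
  · rw [map_smul, A.osMk_con_proj hF hsup hu, smul_zero]
  · have := con_mem_homog φ (proj_mem_homog F hup)
    rw [add_sub_cancel_right] at this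
    exact Submodule.smul_mem _ _ this
  · have key : proj F (con φ (linForm lam * u)) = 0 := by rw [← con_proj hφF, hd, map_zero]
    rw [con_linForm_mul, hsum, map_sub, map_smul, sub_eq_zero] at key
    rw [mul_smul_comm, map_sub, map_smul, map_mul, con_proj hφF, proj_proj, Finset.inter_self,
      ← map_mul, ← key, smul_smul, inv_mul_cancel₀ hS, one_smul, sub_self]

/-- Mayer–Vietoris induction over a family of flats. -/
lemma exists_primitive_of_card_le
    (hlam : ∀ X, A.memL X → X ≠ A.amb → A.denseL X → A.lamX lam X ≠ 0)
    (m : ℕ) : ∀ (𝓕 : Finset (Finset (Fin n))), 𝓕.card ≤ m →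
    (∀ F ∈ 𝓕, A.isFlat F) → ∀ (p : ℤ) (u : ExteriorAlgebra ℂ (Fin n → ℂ)), A.osMk u = 0 →
    u ∈ homog n (p + 1) → (∀ F ∈ 𝓕, proj F (linForm lam * u) = 0) →
    ∃ v, A.osMk v = 0 ∧ v ∈ homog n p ∧ ∀ F ∈ 𝓕, proj F (u - linForm lam * v) = 0 := by
  induction m with
  | zero =>
    intro 𝓕 h𝓕 _ p u _ _ _
    rw [Nat.le_zero, Finset.card_eq_zero] at h𝓕
    exact ⟨0, map_zero _, zero_mem _, by simp [h𝓕]⟩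
  | succ m ih =>
    intro 𝓕 h𝓕 hflat p u hu hup hd
    rcases 𝓕.eq_empty_or_nonempty with rfl | ⟨F, hF⟩
    · exact ⟨0, map_zero _, zero_mem _, by simp⟩
    have hcard : (𝓕.erase F).card ≤ m := by rw [Finset.card_erase_of_mem hF]; omega
    obtain ⟨v, hv, hvp, hvF⟩ := ih (𝓕.erase F) hcard
      (fun G hG => hflat G (Finset.mem_of_mem_erase hG)) p u hu hup
      (fun G hG => hd G (Finset.mem_of_mem_erase hG))
    obtain ⟨w, hw, hwp, hwF⟩ := exists_primitive_of_isFlat hlam (hflat F hF) (p := p)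
      (u := u - linForm lam * v) (by simp [hu, hv])
      (sub_mem hup (linForm_mul_mem_homog lam hvp))
      (by rw [mul_sub, linForm_mul_linForm_mul, sub_zero, hd F hF])
    have hwG : ∀ G ∈ 𝓕.erase F, proj (F ∩ G) (linForm lam * w) = 0 := by
      intro G hG
      have h₁ := proj_eq_zero_of_subset (Finset.inter_subset_left (s₂ := G)) hwF
      rwa [map_sub, proj_eq_zero_of_subset Finset.inter_subset_right (hvF G hG), zero_sub,
        neg_eq_zero] at h₁
    obtain ⟨t, ht, htp, htF⟩ := ih ((𝓕.erase F).image (F ∩ ·)) (Finset.card_image_le.trans hcard)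
      (by
        simp only [Finset.mem_image]
        rintro _ ⟨G, hG, rfl⟩
        exact A.isFlat_inter (hflat F hF) (hflat G (Finset.mem_of_mem_erase hG)))
      (p - 1) w hw (by rwa [sub_add_cancel])
      (by
        simp only [Finset.mem_image]
        rintro _ ⟨G, hG, rfl⟩
        exact hwG G hG)
    refine ⟨v + proj F (w - linForm lam * t), ?_, add_mem hvp (proj_mem_homog F (sub_mem hwp ?_)),
      fun G hG => ?_⟩
    · rw [map_add, hv, zero_add]
      exact A.osMk_proj (hflat F hF) (by simp [hw, ht])
    · have := linForm_mul_mem_homog lam htp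
      rwa [sub_add_cancel] at this
    · rw [mul_add, ← sub_sub, map_sub, map_mul, proj_proj]
      by_cases hGF : G = F
      · subst hGF
        rw [Finset.inter_self, ← map_mul, mul_sub, linForm_mul_linForm_mul, sub_zero, ← map_sub, hwF]
      · have hG' := Finset.mem_erase.2 ⟨hGF, hG⟩
        rw [hvF G hG', Finset.inter_comm, htF _ (Finset.mem_image_of_mem _ hG'), mul_zero, sub_zero]

end Acyclic

section Single

variable {n : ℕ} (i : Fin n)

lemma eq_proj_add_gen_mul_con (x : ExteriorAlgebra ℂ (Fin n → ℂ)) :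
    x = proj (Finset.univ.erase i) x + gen i * con (Pi.single i 1) x := by
  induction x using gen_induction with
  | one => simp [con_one]
  | add x y hx hy =>
    rw [map_add, map_add, mul_add, add_add_add_comm, ← hx, ← hy]
  | smul c x hx => rw [map_smul, map_smul, mul_smul_comm, ← smul_add, ← hx]
  | gen_mul j x hx =>
    rw [map_mul, con_gen_mul, proj_gen]
    by_cases hj : j = i
    · subst hj
      simp [mul_sub, ← mul_assoc, gen_mul_self]
    · simp only [Finset.mem_erase, ne_eq, hj, not_false_eq_true, Finset.mem_univ, and_self, if_true,
        Pi.single_eq_of_ne hj, zero_smul, zero_sub]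
      rw [mul_neg, ← mul_assoc, gen_mul_swap i j, neg_mul, neg_neg, mul_assoc, ← mul_add, ← hx]

lemma con_single_proj_erase (x : ExteriorAlgebra ℂ (Fin n → ℂ)) :
    con (Pi.single i 1) (proj (Finset.univ.erase i) x) = 0 := by
  induction x using gen_induction with
  | one => simp [con_one]
  | add x y hx hy => simp [hx, hy]
  | smul c x hx => simp [hx]
  | gen_mul j x hx =>
    rw [map_mul, proj_gen]
    by_cases hj : j = i
    · simp [hj]
    · simp [hj, con_gen_mul, hx]

lemma proj_proj_erase {S : Finset (Fin n)} (hi : i ∉ S) (x : ExteriorAlgebra ℂ (Fin n → ℂ)) :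
    proj S (proj (Finset.univ.erase i) x) = proj S x := by
  rw [proj_proj, Finset.inter_eq_left.2]
  exact fun j hj => Finset.mem_erase.2 ⟨fun h => hi (h ▸ hj), Finset.mem_univ j⟩

lemma proj_insert {S : Finset (Fin n)} (hi : i ∉ S) (x : ExteriorAlgebra ℂ (Fin n → ℂ)) :
    proj (insert i S) x = proj S x + gen i * proj S (con (Pi.single i 1) x) := by
  have hS : insert i S ∩ Finset.univ.erase i = S := by
    ext j
    by_cases hj : j = i <;> simp [hj, hi]
  have h₁ := eq_proj_add_gen_mul_con i x
  have h₂ := eq_proj_add_gen_mul_con i (con (Pi.single i 1) x)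
  rw [con_con, mul_zero, add_zero] at h₂
  conv_lhs => rw [h₁, map_add, map_mul, proj_gen, if_pos (Finset.mem_insert_self i S), proj_proj, hS]
  conv_lhs => rw [h₂, proj_proj, hS]

lemma proj_con_linForm_mul {lam : Fin n → ℂ} {S : Finset (Fin n)}
    {x : ExteriorAlgebra ℂ (Fin n → ℂ)} (hi : i ∈ S) (hx : proj S (linForm lam * x) = 0) :
    lam i • proj S x = proj S (linForm lam * con (Pi.single i 1) x) := by
  have key : proj S (con (Pi.single i 1) (linForm lam * x)) = 0 := by
    rw [← con_proj fun j hj => Pi.single_eq_of_ne (fun h => hj (by rw [h]; exact hi)) _, hx,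
      map_zero]
  rw [con_linForm_mul, map_sub, map_smul, sub_eq_zero] at key
  simpa [Pi.single_apply] using key

end Single

section Central

variable {W : Type} [AddCommGroup W] [Module ℂ W] {n : ℕ} (A : HArr W n)

/-- The hyperplanes in `S` have a common point on `X`. -/
def centralOn (X : AffineSubspace ℂ W) (S : Finset (Fin n)) : Prop :=
  ∃ o ∈ X, ∀ i ∈ S, o ∈ A.H i

/-- The intersection of the direction of `X` with the directions of the hyperplanes in `S`. -/
def dirOn (X : AffineSubspace ℂ W) (S : Finset (Fin n)) : Submodule ℂ W :=
  X.direction ⊓ S.inf fun i => (A.H i).direction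

lemma dirOn_insert (X : AffineSubspace ℂ W) (S : Finset (Fin n)) (i : Fin n) :
    A.dirOn X (insert i S) = A.dirOn X S ⊓ (A.H i).direction := by
  rw [dirOn, dirOn, Finset.inf_insert, inf_comm (A.H i).direction, inf_assoc]

lemma mem_dirOn {X : AffineSubspace ℂ W} {S : Finset (Fin n)} {v : W} :
    v ∈ A.dirOn X S ↔ v ∈ X.direction ∧ ∀ i ∈ S, v ∈ (A.H i).direction := by
  simp [dirOn, Submodule.mem_finsetInf]

variable {A}

/-- If every central family stays central after adding `i`, contraction with `e_i` is a
homotopy. -/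
lemma exists_primitive_of_cone {lam : Fin n → ℂ} {X : AffineSubspace ℂ W} {U : Finset (Fin n)}
    {i : Fin n} (hi : i ∈ U) (hlam : lam i ≠ 0)
    (hcone : ∀ S ⊆ U, A.centralOn X S → A.centralOn X (insert i S)) {p : ℤ}
    {z : ExteriorAlgebra ℂ (Fin n → ℂ)} (hzp : z ∈ homog n p)
    (hz : ∀ S ⊆ U, A.centralOn X S → proj S (linForm lam * z) = 0) :
    ∃ y ∈ homog n (p - 1), ∀ S ⊆ U, A.centralOn X S → proj S (z - linForm lam * y) = 0 := by
  refine ⟨(lam i)⁻¹ • con (Pi.single i 1) z, Submodule.smul_mem _ _ (con_mem_homog _ hzp),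
    fun S hS hc => ?_⟩
  refine proj_eq_zero_of_subset (Finset.subset_insert i S) ?_
  have h := proj_con_linForm_mul i (Finset.mem_insert_self i S)
    (hz _ (Finset.insert_subset hi hS) (hcone S hS hc))
  rw [mul_smul_comm, map_sub, map_smul, ← h, smul_smul, inv_mul_cancel₀ hlam, one_smul, sub_self]

lemma centralOn_inf_iff {X : AffineSubspace ℂ W} {S : Finset (Fin n)} {i : Fin n} :
    A.centralOn (X ⊓ A.H i) S ↔ A.centralOn X (insert i S) := by
  simp [centralOn, AffineSubspace.mem_inf_iff, and_assoc]

lemma centralOn.mono {X : AffineSubspace ℂ W} {S T : Finset (Fin n)} (h : A.centralOn X T)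
    (hST : S ⊆ T) : A.centralOn X S := by
  obtain ⟨o, ho, hT⟩ := h
  exact ⟨o, ho, fun i hi => hT i (hST hi)⟩

/-- Deletion–restriction gluing of primitives. -/
lemma exists_primitive_of_deletion_link {lam : Fin n → ℂ} {X : AffineSubspace ℂ W}
    {U : Finset (Fin n)} {i : Fin n} (hi : i ∉ U) {p : ℤ}
    (hdel : ∀ z ∈ homog n p, (∀ S ⊆ U, A.centralOn X S → proj S (linForm lam * z) = 0) →
      ∃ y ∈ homog n (p - 1), ∀ S ⊆ U, A.centralOn X S → proj S (z - linForm lam * y) = 0)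
    (hlink : ∀ z ∈ homog n (p - 1),
      (∀ S ⊆ U, A.centralOn (X ⊓ A.H i) S → proj S (linForm lam * z) = 0) →
      ∃ y ∈ homog n (p - 1 - 1),
        ∀ S ⊆ U, A.centralOn (X ⊓ A.H i) S → proj S (z - linForm lam * y) = 0)
    {z : ExteriorAlgebra ℂ (Fin n → ℂ)} (hzp : z ∈ homog n p)
    (hz : ∀ S ⊆ insert i U, A.centralOn X S → proj S (linForm lam * z) = 0) :
    ∃ y ∈ homog n (p - 1), ∀ S ⊆ insert i U, A.centralOn X S →
      proj S (z - linForm lam * y) = 0 := by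
  obtain ⟨y, hyp, hy⟩ := hdel z hzp fun S hS => hz S (hS.trans (Finset.subset_insert i U))
  have hmem : z - linForm lam * y ∈ homog n p := by
    have := linForm_mul_mem_homog lam hyp
    rw [sub_add_cancel] at this
    exact sub_mem hzp this
  set z₁ := z - linForm lam * y with hz₁
  have hωz₁ : linForm lam * z₁ = linForm lam * z := by
    rw [hz₁, mul_sub, linForm_mul_linForm_mul, sub_zero]
  obtain ⟨t, htp, ht⟩ := hlink (con (Pi.single i 1) z₁) (con_mem_homog _ hmem) fun S hS hc => by
    have hc' := centralOn_inf_iff.1 hc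
    have h := proj_con_linForm_mul i (x := z₁) (lam := lam) (Finset.mem_insert_self i S)
      (by rw [hωz₁]; exact hz _ (Finset.insert_subset_insert i hS) hc')
    have h₀ : proj S (lam i • z₁ - linForm lam * con (Pi.single i 1) z₁) = 0 :=
      proj_eq_zero_of_subset (Finset.subset_insert i S) (by rw [map_sub, map_smul, h, sub_self])
    rwa [map_sub, map_smul, hy S hS (hc'.mono (Finset.subset_insert i S)), smul_zero, zero_sub,
      neg_eq_zero] at h₀
  set t' := proj (Finset.univ.erase i) t with ht'
  have hdelz : ∀ S ⊆ U, A.centralOn X S → proj S (z - linForm lam * (y - gen i * t')) = 0 := by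
    intro S hS hc
    have hiS : i ∉ S := fun h => hi (hS h)
    rw [mul_sub, ← sub_add, ← hz₁, map_add, hy S hS hc, map_mul, map_mul, proj_gen, if_neg hiS,
      zero_mul, mul_zero, add_zero]
  refine ⟨y - gen i * t', sub_mem hyp ?_, fun S hS hc => ?_⟩
  · have := gen_mul_mem_homog i (proj_mem_homog (Finset.univ.erase i) htp)
    rwa [sub_add_cancel] at this
  by_cases hiS : i ∈ S
  · obtain ⟨T, hiT, rfl⟩ : ∃ T, i ∉ T ∧ insert i T = S :=
      ⟨S.erase i, Finset.notMem_erase i S, Finset.insert_erase hiS⟩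
    have hTU : T ⊆ U := (Finset.insert_subset_insert_iff hiT).1 hS
    have hcon : con (Pi.single i 1) (z - linForm lam * (y - gen i * t')) =
        con (Pi.single i 1) z₁ - linForm lam * t' + lam i • (gen i * t') := by
      rw [mul_sub, ← sub_add, ← hz₁, map_add, con_linForm_mul, con_gen_mul, ht',
        con_single_proj_erase]
      simp [Pi.single_apply]
      abel
    rw [proj_insert i hiT, hdelz T hTU (hc.mono (Finset.subset_insert i T)), hcon, zero_add,
      map_add, map_smul, map_mul _ (gen i), proj_gen, if_neg hiT, zero_mul, smul_zero, add_zero,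
      map_sub, map_mul, ht', proj_proj_erase i hiT, ← map_mul, ← map_sub,
      ht T hTU (centralOn_inf_iff.2 hc), mul_zero]
  · exact hdelz S ((Finset.subset_insert_iff_of_notMem hiS).1 hS) hc

variable [FiniteDimensional ℂ W]

lemma direction_sup_span {i : Fin n} {v : W} (hv : v ∈ A.amb.direction)
    (hvi : v ∉ (A.H i).direction) :
    (A.H i).direction ⊔ Submodule.span ℂ {v} = A.amb.direction := by
  have hle : (A.H i).direction ⊔ Submodule.span ℂ {v} ≤ A.amb.direction :=
    sup_le (AffineSubspace.direction_le (A.le_amb i)) (by simpa using hv)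
  refine Submodule.eq_of_le_of_finrank_le hle ?_
  have hlt : (A.H i).direction < (A.H i).direction ⊔ Submodule.span ℂ {v} :=
    lt_of_le_of_ne le_sup_left fun h => hvi (h ▸ Submodule.mem_sup_right
      (Submodule.mem_span_singleton_self v))
  have := Submodule.finrank_lt_finrank_of_lt hlt
  have := A.hyp i
  omega

lemma exists_smul_vadd_mem {i : Fin n} {v o : W} (ho : o ∈ A.amb) (hv : v ∈ A.amb.direction)
    (hvi : v ∉ (A.H i).direction) : ∃ c : ℂ, c • v +ᵥ o ∈ A.H i := by
  obtain ⟨h, hh⟩ := A.nonemptyH i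
  have hmem : h -ᵥ o ∈ A.amb.direction := AffineSubspace.vsub_mem_direction (A.le_amb i hh) ho
  rw [← direction_sup_span hv hvi] at hmem
  obtain ⟨d, hd, w, hw, heq⟩ := Submodule.mem_sup.1 hmem
  obtain ⟨c, rfl⟩ := Submodule.mem_span_singleton.1 hw
  refine ⟨c, ?_⟩
  have : c • v +ᵥ o = -d +ᵥ h := by
    simp only [vadd_eq_add, vsub_eq_sub] at heq ⊢
    rw [← sub_add_cancel h o, ← heq]
    abel
  rw [this]
  exact AffineSubspace.vadd_mem_of_mem_direction (neg_mem hd) hh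

lemma centralOn_insert {X : AffineSubspace ℂ W} (hX : X ≤ A.amb) {U S : Finset (Fin n)} {i : Fin n}
    (h : ¬ A.dirOn X U ≤ (A.H i).direction) (hS : S ⊆ U) (hc : A.centralOn X S) :
    A.centralOn X (insert i S) := by
  obtain ⟨v, hv, hvi⟩ := SetLike.not_le_iff_exists.1 h
  obtain ⟨o, ho, hoS⟩ := hc
  rw [mem_dirOn] at hv
  obtain ⟨c, hc⟩ := exists_smul_vadd_mem (hX ho) (AffineSubspace.direction_le hX hv.1) hvi
  refine ⟨c • v +ᵥ o, AffineSubspace.vadd_mem_of_mem_direction (Submodule.smul_mem _ c hv.1) ho,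
    fun j hj => ?_⟩
  rcases Finset.mem_insert.1 hj with rfl | hj
  · exact hc
  · exact AffineSubspace.vadd_mem_of_mem_direction (Submodule.smul_mem _ c (hv.2 j (hS hj)))
      (hoS j hj)

lemma finrank_inf_direction {D : Submodule ℂ W} (hD : D ≤ A.amb.direction) {i : Fin n}
    (h : ¬ D ≤ (A.H i).direction) :
    finrank ℂ (D ⊓ (A.H i).direction : Submodule ℂ W) + 1 = finrank ℂ D := by
  obtain ⟨v, hv, hvi⟩ := SetLike.not_le_iff_exists.1 h
  have hsup : D ⊔ (A.H i).direction = A.amb.direction := by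
    refine le_antisymm (sup_le hD (AffineSubspace.direction_le (A.le_amb i))) ?_
    rw [← direction_sup_span (hD hv) hvi]
    exact sup_le le_sup_right (le_sup_of_le_left (by simpa using hv))
  have h₁ := Submodule.finrank_sup_add_finrank_inf_eq D (A.H i).direction
  have h₂ := A.hyp i
  rw [hsup] at h₁
  omega

/-- If all weights are nonzero, the complex of the nerve of central families is exact below
the rank. -/
lemma exists_primitive_on_centralOn {lam : Fin n → ℂ} (hlam : ∀ i, lam i ≠ 0)
    (U : Finset (Fin n)) : ∀ X ≤ A.amb, ∀ p q : ℤ,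
    (finrank ℂ (A.dirOn X U) : ℤ) + q ≤ finrank ℂ X.direction → p < q →
    ∀ z ∈ homog n p, (∀ S ⊆ U, A.centralOn X S → proj S (linForm lam * z) = 0) →
    ∃ y ∈ homog n (p - 1), ∀ S ⊆ U, A.centralOn X S → proj S (z - linForm lam * y) = 0 := by
  induction U using Finset.induction_on with
  | empty =>
    intro X _ p q hq hpq z hz _
    have h : A.dirOn X ∅ = X.direction := by simp [dirOn]
    rw [h] at hq
    rw [homog_of_neg (by omega), Submodule.mem_bot] at hz
    exact ⟨0, zero_mem _, by simp [hz]⟩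
  | insert i U hi ih =>
    intro X hX p q hq hpq z hzp hz
    rw [dirOn_insert] at hq
    by_cases hXi : X ≤ A.H i
    · refine exists_primitive_of_cone (Finset.mem_insert_self i U) (hlam i) ?_ hzp hz
      rintro S - ⟨o, ho, hS⟩
      exact ⟨o, ho, (Finset.forall_mem_insert _ _ _).2 ⟨hXi ho, hS⟩⟩
    by_cases hne : ∃ o ∈ X, o ∈ A.H i
    · by_cases hD : A.dirOn X U ≤ (A.H i).direction
      · rw [inf_eq_left.2 hD] at hq
        obtain ⟨o, hoX, hoi⟩ := hne
        have hdir : (X ⊓ A.H i).direction = X.direction ⊓ (A.H i).direction :=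
          AffineSubspace.direction_inf_of_mem hoX hoi
        have hfin := finrank_inf_direction (AffineSubspace.direction_le hX) (i := i)
          fun h => hXi (le_of_direction_le hoX hoi h)
        have hD' : A.dirOn (X ⊓ A.H i) U = A.dirOn X U := by
          rw [dirOn, hdir, inf_right_comm]
          exact inf_eq_left.2 hD
        refine exists_primitive_of_deletion_link hi (ih X hX p q hq hpq)
          (ih (X ⊓ A.H i) (inf_le_left.trans hX) (p - 1) (q - 1) ?_ (by omega)) hzp hz
        rw [hD', hdir]
        omega
      · refine exists_primitive_of_cone (Finset.mem_insert_self i U) (hlam i) ?_ hzp hz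
        intro S hS hc
        by_cases hiS : i ∈ S
        · rwa [Finset.insert_eq_of_mem hiS]
        · exact centralOn_insert hX hD ((Finset.subset_insert_iff_of_notMem hiS).1 hS) hc
    · have hD : A.dirOn X U ≤ (A.H i).direction := by
        by_contra hD
        by_cases hXne : ∃ o, o ∈ X
        · obtain ⟨o, ho⟩ := hXne
          obtain ⟨o', ho', h⟩ := centralOn_insert hX hD (Finset.empty_subset U) ⟨o, ho, by simp⟩
          exact hne ⟨o', ho', h i (Finset.mem_insert_self i ∅)⟩
        · refine hXi fun o ho => absurd ⟨o, ho⟩ hXne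
      rw [inf_eq_left.2 hD] at hq
      have hsub : ∀ S ⊆ insert i U, A.centralOn X S → S ⊆ U := by
        rintro S hS ⟨o, ho, hoS⟩
        exact (Finset.subset_insert_iff_of_notMem fun h => hne ⟨o, ho, hoS i h⟩).1 hS
      obtain ⟨y, hyp, hy⟩ := ih X hX p q hq hpq z hzp fun S hS =>
        hz S (hS.trans (Finset.subset_insert i U))
      exact ⟨y, hyp, fun S hS hc => hy S (hsub S hS hc) hc⟩

end Central

section Main

variable {W : Type} [AddCommGroup W] [Module ℂ W] {n : ℕ} (A : HArr W n)

lemma omLam_eq (lam : Fin n → ℂ) : A.omLam lam = A.osMk (linForm lam) := by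
  simp [omLam, om, linForm]

lemma exists_lift_of_mem_deg {p : ℕ} {x : OS A} (hx : x ∈ A.deg p) :
    ∃ u ∈ homog n p, A.osMk u = x := by
  have : A.deg p ≤ (homog n p).map A.osMk.toLinearMap := by
    rw [deg, Submodule.span_le]
    rintro _ ⟨S, hS, rfl⟩
    exact ⟨eS S, eS_mem_homog (by rw [hS]), rfl⟩
  exact this hx

lemma osMk_mem_deg {p : ℕ} {u : ExteriorAlgebra ℂ (Fin n → ℂ)} (hu : u ∈ homog n p) :
    A.osMk u ∈ A.deg p := by
  have : homog n p ≤ (A.deg p).comap A.osMk.toLinearMap := by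
    rw [homog, Submodule.span_le]
    rintro _ ⟨S, hS, rfl⟩
    exact Submodule.subset_span ⟨S, by exact_mod_cast hS, rfl⟩
  exact this hu

lemma centralOn_amb_iff {S : Finset (Fin n)} : A.centralOn A.amb S ↔ A.inter S ≠ ⊥ :=
  ⟨fun ⟨_, ho, hS⟩ => ne_bot_of_mem ((mem_inter A).2 ⟨ho, hS⟩), fun h =>
    (exists_mem_of_ne_bot h).imp fun _ ho => (mem_inter A).1 ho⟩

variable [FiniteDimensional ℂ W]

variable {A} {lam : Fin n → ℂ}

lemma lam_ne_zero
    (hlam : ∀ X, A.memL X → X ≠ A.amb → A.denseL X → A.lamX lam X ≠ 0)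
    (i : Fin n) : lam i ≠ 0 := by
  have hi : A.inter {i} = A.H i := by simp [inter, A.le_amb i]
  have hb : A.H i ≠ ⊥ := (AffineSubspace.nonempty_iff_ne_bot _).1 (A.nonemptyH i)
  have hflat := A.isFlat_sub_inter (S := {i}) (by rwa [hi])
  rw [hi] at hflat
  obtain ⟨S, hS, -, hne⟩ := A.exists_transversal hlam hflat ⟨i, (mem_sub A).2 le_rfl⟩
  have hsub : A.sub (A.H i) = {i} := by
    refine Finset.eq_singleton_iff_unique_mem.2 ⟨(mem_sub A).2 le_rfl, fun j hj => ?_⟩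
    obtain ⟨o, ho⟩ := A.nonemptyH i
    have hle := (mem_sub A).1 hj
    refine A.inj (AffineSubspace.ext_of_direction_eq ?_ ⟨o, hle ho, ho⟩)
    refine (Submodule.eq_of_le_of_finrank_eq (AffineSubspace.direction_le hle) ?_).symm
    have h₁ := A.hyp i
    have h₂ := A.hyp j
    omega
  rw [hsub] at hS
  rcases Finset.subset_singleton_iff.1 hS with rfl | rfl
  · simp at hne
  · simpa using hne

lemma exists_primitive
    (hlam : ∀ X, A.memL X → X ≠ A.amb → A.denseL X → A.lamX lam X ≠ 0)
    {p : ℤ} (hp : p < A.rank) {x : ExteriorAlgebra ℂ (Fin n → ℂ)}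
    (hx : x ∈ homog n p) (hd : A.osMk (linForm lam * x) = 0) :
    ∃ y ∈ homog n (p - 1), A.osMk x = A.osMk (linForm lam * y) := by
  classical
  obtain ⟨v, hv, hvp, hvF⟩ := exists_primitive_of_card_le hlam _
    (Finset.univ.filter A.isFlat) le_rfl (fun F hF => (Finset.mem_filter.1 hF).2) p
    (linForm lam * x) hd (linForm_mul_mem_homog lam hx)
    (fun F _ => by rw [linForm_mul_linForm_mul, map_zero])
  have hrank := A.rank_add_finrank_le
  obtain ⟨y, hyp, hy⟩ := exists_primitive_on_centralOn (lam_ne_zero hlam) Finset.univ A.amb le_rfl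
    p A.rank (by rw [add_comm]; exact_mod_cast hrank) hp (x - v) (sub_mem hx hvp)
    fun S _ hS => by
      rw [centralOn_amb_iff] at hS
      refine proj_eq_zero_of_subset (A.subset_sub_inter S) ?_
      rw [mul_sub]
      exact hvF _ (Finset.mem_filter.2 ⟨Finset.mem_univ _, A.isFlat_sub_inter hS⟩)
  refine ⟨y, hyp, ?_⟩
  have hmem := mem_span_eS_of_proj_eq_zero (Finset.univ.filter fun S => A.inter S ≠ ⊥)
    (x := x - v - linForm lam * y) fun S hS =>
      hy S (Finset.subset_univ S) (A.centralOn_amb_iff.2 (Finset.mem_filter.1 hS).2)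
  have hker : A.osMk (x - v - linForm lam * y) = 0 := by
    refine (Submodule.span_le (p := LinearMap.ker A.osMk.toLinearMap)).2 ?_ hmem
    rintro _ ⟨T, hT, rfl⟩
    refine A.osMk_eS_of_inter_eq_bot ?_
    by_contra hne
    exact hT T (Finset.mem_filter.2 ⟨Finset.mem_univ T, hne⟩) subset_rfl
  rwa [map_sub, map_sub, hv, sub_zero, sub_eq_zero] at hker

end Main

end HArr
open scoped Classical
/-- Yuzvinsky. If `λ(X) ≠ 0` for every dense `X ∈ L ∖ {V}`, the complex
`(A^•, ω_λ ∧ ·)` is exact in all degrees below `r`: the kernel of `ω_λ ∧ · : A^p → A^{p+1}`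
equals `ω_λ ∧ A^{p−1}` (which is `0` for `p = 0`). -/
theorem os_complex_exact_below_rank {W : Type} [AddCommGroup W] [Module ℂ W]
    [FiniteDimensional ℂ W] {n : ℕ} (A : HArr W n) (lam : Fin n → ℂ)
    (hlam : ∀ X, A.memL X → X ≠ A.amb → A.denseL X → A.lamX lam X ≠ 0) :
    (0 < A.rank → ∀ x ∈ A.deg 0, A.omLam lam * x = 0 → x = 0) ∧
    (∀ p : ℕ, p + 1 < A.rank → ∀ x ∈ A.deg (p + 1),
      (A.omLam lam * x = 0 ↔ ∃ y ∈ A.deg p, x = A.omLam lam * y)) := by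
  refine ⟨fun hr x hx h => ?_, fun p hp x hx => ⟨fun h => ?_, ?_⟩⟩
  · obtain ⟨u, hu, rfl⟩ := A.exists_lift_of_mem_deg hx
    rw [HArr.omLam_eq, ← map_mul] at h
    obtain ⟨y, hyp, hy⟩ := HArr.exists_primitive hlam (by exact_mod_cast hr) hu h
    rw [HArr.homog_of_neg (by simp), Submodule.mem_bot] at hyp
    rw [hy, hyp, mul_zero, map_zero]
  · obtain ⟨u, hu, rfl⟩ := A.exists_lift_of_mem_deg hx
    rw [HArr.omLam_eq, ← map_mul] at h
    obtain ⟨y, hyp, hy⟩ := HArr.exists_primitive hlam (by exact_mod_cast hp) hu h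
    rw [Nat.cast_succ, add_sub_cancel_right] at hyp
    exact ⟨A.osMk y, A.osMk_mem_deg hyp, by rw [hy, map_mul, HArr.omLam_eq]⟩
  · rintro ⟨y, -, rfl⟩
    rw [HArr.omLam_eq, ← mul_assoc, ← map_mul, HArr.linForm_mul_self, map_zero, zero_mul]
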